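/- Consider the problem of minimizing F(Θ) = Σ_{k=1}^{p} [(1/2)(Θ_k − a_k)² + λ|Θ_k|] over Θ ∈ ℝ^p subject to the constraint Σ_{k=1}^{p} s_k · 𝟙[Θ_k ≠ 0] ≤ b, where s_k ≥ 0 and b ≥ 0. Then an optimal solution is Θ_k = w_k · sign(a_k) · max(|a_k| − λ, 0), where w ∈ {0,1}^p solves the 0-1 knapsack problem: maximize Σ_k μ_k w_k subject to Σ_k s_k w_k ≤ b, with μ_k = (max(|a_k| − λ, 0))²/2. -/

import Mathlib

open Finset

/-- The scalar LASSO proximal objective at the soft-thresholding point. -/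
theorem lasso_prox_softThreshold_eq (a lam : ℝ) (hlam : 0 ≤ lam) :
    (1/2) * (Real.sign a * max (|a| - lam) 0 - a)^2 +
      lam * |Real.sign a * max (|a| - lam) 0| =
      (1/2) * a^2 - (max (|a| - lam) 0)^2 / 2 := by
  rcases le_total (|a|) lam with h | h
  · rw [max_eq_right (by linarith)]
    simp
  · rw [max_eq_left (by linarith)]
    rcases lt_trichotomy a 0 with ha | rfl | ha
    · rw [Real.sign_of_neg ha, abs_mul, abs_neg, abs_one, one_mul,
        abs_of_nonneg (sub_nonneg.2 h), abs_of_neg ha]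
      ring
    · have : lam = 0 := le_antisymm (by simpa using h) hlam
      simp [this]
    · rw [Real.sign_of_pos ha, abs_mul, abs_one, one_mul, one_mul,
        abs_of_nonneg (sub_nonneg.2 h), abs_of_pos ha]
      ring

/-- A lower bound for the scalar LASSO proximal objective at every point. -/
theorem lasso_prox_lower_bound (a lam t : ℝ) :
    (1/2) * a^2 - (max (|a| - lam) 0)^2 / 2 ≤ (1/2) * (t - a)^2 + lam * |t| := by
  have h1 : t * a ≤ |t| * |a| := by
    rw [← abs_mul]
    exact le_abs_self _
  have h2 : |t| * (|a| - lam) ≤ |t| * max (|a| - lam) 0 :=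
    mul_le_mul_of_nonneg_left (le_max_left _ _) (abs_nonneg t)
  nlinarith [sq_nonneg (|t| - max (|a| - lam) 0), sq_abs t]

/-- The budget-constrained separable LASSO proximal problem is solved by
soft-thresholding combined with a 0-1 knapsack selection. -/
theorem budget_constrained_prox_knapsack
    (p : ℕ) (a s : Fin p → ℝ) (lam b : ℝ)
    (hlam : 0 ≤ lam) (hs : ∀ k, 0 ≤ s k) (hb : 0 ≤ b)
    (w : Fin p → ℝ) (hw01 : ∀ k, w k = 0 ∨ w k = 1)
    (hwfeas : ∑ k, s k * w k ≤ b)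
    (hwopt : ∀ w' : Fin p → ℝ, (∀ k, w' k = 0 ∨ w' k = 1) →
      ∑ k, s k * w' k ≤ b →
      ∑ k, ((max (|a k| - lam) 0)^2 / 2) * w' k ≤
        ∑ k, ((max (|a k| - lam) 0)^2 / 2) * w k) :
    let Θstar : Fin p → ℝ := fun k => w k * (Real.sign (a k) * max (|a k| - lam) 0)
    let F : (Fin p → ℝ) → ℝ := fun Θ => ∑ k, ((1/2) * (Θ k - a k)^2 + lam * |Θ k|)
    (∑ k, s k * (if Θstar k ≠ 0 then (1:ℝ) else 0)) ≤ b ∧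
    ∀ Θ : Fin p → ℝ, (∑ k, s k * (if Θ k ≠ 0 then (1:ℝ) else 0)) ≤ b →
      F Θstar ≤ F Θ := by
  intro Θstar F
  refine ⟨le_trans (sum_le_sum fun k _ => mul_le_mul_of_nonneg_left ?_ (hs k)) hwfeas, ?_⟩
  · rcases hw01 k with h | h
    · simp [Θstar, h]
    · rw [h]
      split_ifs <;> norm_num
  · intro Θ hΘ
    have hknap := hwopt (fun k => if Θ k ≠ 0 then (1:ℝ) else 0)
      (fun k => (ite_eq_or_eq _ _ _).symm) hΘ
    have hstar : F Θstar =
        ∑ k, (1/2) * (a k)^2 - ∑ k, ((max (|a k| - lam) 0)^2 / 2) * w k := by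
      rw [← sum_sub_distrib]
      refine sum_congr rfl fun k _ => ?_
      rcases hw01 k with h | h
      · simp [Θstar, h]
      · simpa only [Θstar, h, one_mul, mul_one] using
          lasso_prox_softThreshold_eq (a k) lam hlam
    have hlower : ∑ k, (1/2) * (a k)^2 -
        ∑ k, ((max (|a k| - lam) 0)^2 / 2) * (if Θ k ≠ 0 then (1:ℝ) else 0) ≤ F Θ := by
      rw [← sum_sub_distrib]
      refine sum_le_sum fun k _ => ?_
      by_cases h : Θ k = 0
      · simp [h]
      · simpa only [ne_eq, h, not_false_eq_true, if_true, mul_one] using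
          lasso_prox_lower_bound (a k) lam (Θ k)
    linarith
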